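/- arXiv:2004.02444 — 10 statements merged into one kernel-verified Lean document; each statement's English description precedes it below -/
import Mathlib

section
/- For any finite nonnegative Borel measure μ on K, a continuous real-valued function g on K satisfies ⟨ν − μ, g⟩ ≤ 0 for every finite nonnegative Borel measure ν on K if and only if g(x) ≤ 0 for all x ∈ K and g(x) = 0 for all x in the topological support of μ. (Characterisation of the normal cone to M_+(K) at μ.) -/
open MeasureTheory Filter

/-- The topological support of a Borel measure: the set of points all of whose open
neighbourhoods have positive measure. -/
def msupport {K : Type*} [TopologicalSpace K] [MeasurableSpace K] (μ : Measure K) : Set K :=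
  {x | ∀ U : Set K, x ∈ U → IsOpen U → μ U ≠ 0}

-- The negative log-likelihood `ℓ(μ) = ⟨μ, f⟩ - ∑_{γ ∈ Γ} log ⟨μ, γ⟩`, with value `+∞`
-- outside of its domain `dom(ℓ) = {μ : ⟨μ, γ⟩ > 0 for all γ ∈ Γ}`.
open Classical in
noncomputable def loss {K : Type*} [TopologicalSpace K] [MeasurableSpace K]
    (f : C(K, ℝ)) (Γ : Finset C(K, ℝ)) (μ : Measure K) : EReal :=
  if ∀ γ ∈ Γ, 0 < ∫ x, γ x ∂μ then
    (((∫ x, f x ∂μ) - ∑ γ ∈ Γ, Real.log (∫ x, γ x ∂μ) : ℝ) : EReal)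
  else ⊤

/-- The real-valued negative log-likelihood, for measures in the domain. -/
noncomputable def lossR {K : Type*} [TopologicalSpace K] [MeasurableSpace K]
    (f : C(K, ℝ)) (Γ : Finset C(K, ℝ)) (μ : Measure K) : ℝ :=
  (∫ x, f x ∂μ) - ∑ γ ∈ Γ, Real.log (∫ x, γ x ∂μ)

/-- The ML-EM map `T`, sending `μ` to the measure with density
`x ↦ (1/f(x)) ∑_{γ∈Γ} γ(x)/⟨μ,γ⟩` with respect to `μ`. -/
noncomputable def mlem {K : Type*} [TopologicalSpace K] [MeasurableSpace K]
    (f : C(K, ℝ)) (Γ : Finset C(K, ℝ)) (μ : Measure K) : Measure K :=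
  μ.withDensity (fun x => ENNReal.ofReal ((f x)⁻¹ * ∑ γ ∈ Γ, γ x / (∫ y, γ y ∂μ)))

/-- Kullback–Leibler divergence `D(μ‖ν) = ∫ log(dμ/dν) dμ`. -/
noncomputable def KL {K : Type*} [MeasurableSpace K] (μ ν : Measure K) : ℝ :=
  ∫ x, Real.log ((μ.rnDeriv ν x).toReal) ∂μ

/-- The probability measure `ν_γ(μ) = (γ/⟨μ,γ⟩)·μ`. -/
noncomputable def nug {K : Type*} [TopologicalSpace K] [MeasurableSpace K]
    (γ : C(K, ℝ)) (μ : Measure K) : Measure K :=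
  μ.withDensity (fun x => ENNReal.ofReal (γ x / (∫ y, γ y ∂μ)))

/-- The measure `f·ν`, with density `f` with respect to `ν`. -/
noncomputable def fdot {K : Type*} [TopologicalSpace K] [MeasurableSpace K]
    (f : C(K, ℝ)) (ν : Measure K) : Measure K :=
  ν.withDensity (fun x => ENNReal.ofReal (f x))

/-- The surrogate `Q_k(μ) = ℓ(μ) + ∑_{γ∈Γ} D(ν_γ(μ_k) ‖ ν_γ(μ))`. -/
noncomputable def Qsur {K : Type*} [TopologicalSpace K] [MeasurableSpace K]
    (f : C(K, ℝ)) (Γ : Finset C(K, ℝ)) (μk μ : Measure K) : ℝ :=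
  lossR f Γ μ + ∑ γ ∈ Γ, KL (nug γ μk) (nug γ μ)

lemma msupport_eq_support {K : Type*} [TopologicalSpace K] [MeasurableSpace K] (μ : Measure K) :
    msupport μ = μ.support := by
  rw [Measure.support_eq_forall_isOpen]
  simp only [msupport, pos_iff_ne_zero]

lemma ae_mem_msupport {K : Type*} [TopologicalSpace K] [HereditarilyLindelofSpace K]
    [MeasurableSpace K] (μ : Measure K) : ∀ᵐ x ∂μ, x ∈ msupport μ := by
  rw [msupport_eq_support]
  exact Measure.support_mem_ae

lemma eq_zero_of_mem_msupport_of_ae_eq_zero {K : Type*} [TopologicalSpace K] [MeasurableSpace K]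
    {μ : Measure K} {g : C(K, ℝ)} (hg : g =ᵐ[μ] 0) {x : K} (hx : x ∈ msupport μ) : g x = 0 := by
  by_contra h
  exact hx {y | g y ≠ 0} h (isOpen_ne_fun g.continuous continuous_const) (ae_iff.mp hg)

/-- Characterisation of the normal cone to `M₊(K)` at `μ`. -/
theorem stmt0 {K : Type*} [MetricSpace K] [CompactSpace K] [Nonempty K]
    [MeasurableSpace K] [BorelSpace K]
    (μ : Measure K) [IsFiniteMeasure μ] (g : C(K, ℝ)) :
    (∀ ν : Measure K, IsFiniteMeasure ν → (∫ x, g x ∂ν) - (∫ x, g x ∂μ) ≤ 0) ↔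
      ((∀ x : K, g x ≤ 0) ∧ ∀ x ∈ msupport μ, g x = 0) := by
  have g_integrable (ν : Measure K) [IsFiniteMeasure ν] : Integrable g ν :=
    g.continuous.integrable_of_hasCompactSupport (HasCompactSupport.of_compactSpace g)
  constructor
  · intro h
    have hle : ∀ x, g x ≤ 0 := fun x => by
      have hx := h (μ + Measure.dirac x) inferInstance
      rw [integral_add_measure (g_integrable μ) (g_integrable _), integral_dirac] at hx
      linarith
    have hint : ∫ x, g x ∂μ = 0 := by
      have h0 := h 0 inferInstance
      rw [integral_zero_measure] at h0
      exact le_antisymm (integral_nonpos hle) (by linarith)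
    have hae : g =ᵐ[μ] 0 := by
      have hneg := (integral_eq_zero_iff_of_nonneg (f := fun x => -g x)
        (fun x => neg_nonneg.mpr (hle x)) (g_integrable μ).neg).mp
        (by rw [integral_neg, hint, neg_zero])
      filter_upwards [hneg] with x hx using neg_eq_zero.mp hx
    exact ⟨hle, fun x hx => eq_zero_of_mem_msupport_of_ae_eq_zero hae hx⟩
  · rintro ⟨hle, hzero⟩ ν _
    have hint : ∫ x, g x ∂μ = 0 :=
      integral_eq_zero_of_ae ((ae_mem_msupport μ).mono hzero)
    rw [hint, sub_zero]
    exact integral_nonpos hle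
end

section
/- If a measure μ ∈ dom(ℓ) satisfies Σ_{γ∈Γ} γ(x)/⟨μ, γ⟩ = f(x) for every x ∈ K, then μ minimizes ℓ over M_+(K). -/
open MeasureTheory Filter

/-- If `f = ∑ γ / a γ`, then `⟨ν, f⟩ = ∑ ⟨ν, γ⟩ / a γ` for every finite measure `ν`. -/
theorem integral_eq_sum_integral_div {K : Type*} [TopologicalSpace K] [CompactSpace K]
    [MeasurableSpace K] [OpensMeasurableSpace K] (f : C(K, ℝ)) (Γ : Finset C(K, ℝ))
    (a : C(K, ℝ) → ℝ) (h : ∀ x, (∑ γ ∈ Γ, γ x / a γ) = f x)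
    (ν : Measure K) [IsFiniteMeasure ν] :
    ∫ x, f x ∂ν = ∑ γ ∈ Γ, (∫ x, γ x ∂ν) / a γ := by
  simp_rw [← h, ← integral_div]
  refine integral_finsetSum Γ fun γ _ => Integrable.div_const ?_ _
  exact γ.continuous.integrable_of_hasCompactSupport (HasCompactSupport.of_compactSpace γ)

/-- A sufficient optimality condition. -/
theorem stmt2 {K : Type*} [MetricSpace K] [CompactSpace K] [Nonempty K]
    [MeasurableSpace K] [BorelSpace K]
    (f : C(K, ℝ)) (c : ℝ) (hc : 0 < c) (hf : ∀ x : K, c ≤ f x)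
    (Γ : Finset C(K, ℝ)) (hΓ : Γ.Nonempty) (hΓpos : ∀ γ ∈ Γ, ∀ x : K, 0 ≤ γ x)
    (μ : Measure K) [IsFiniteMeasure μ] (hdom : ∀ γ ∈ Γ, 0 < ∫ x, γ x ∂μ)
    (heq : ∀ x : K, (∑ γ ∈ Γ, γ x / (∫ y, γ y ∂μ)) = f x) :
    ∀ ν : Measure K, IsFiniteMeasure ν → loss f Γ μ ≤ loss f Γ ν := by
  intro ν _
  unfold loss
  rw [if_pos hdom]
  split_ifs with hν
  · rw [EReal.coe_le_coe_iff, integral_eq_sum_integral_div f Γ _ heq μ,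
      integral_eq_sum_integral_div f Γ _ heq ν, ← Finset.sum_sub_distrib,
      ← Finset.sum_sub_distrib]
    refine Finset.sum_le_sum fun γ hγ => ?_
    have hlog := Real.log_le_sub_one_of_pos (div_pos (hν γ hγ) (hdom γ hγ))
    rw [Real.log_div (hν γ hγ).ne' (hdom γ hγ).ne'] at hlog
    rw [div_self (hdom γ hγ).ne']
    linarith
  · exact le_top
end

section
/- The infimum of ℓ over M_+(K) is attained: assuming dom(ℓ) is nonempty, there exists μ* ∈ M_+(K) such that ℓ(μ*) ≤ ℓ(μ) for all μ ∈ M_+(K). -/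
open MeasureTheory Filter

/-- Coercivity of `(m, t) ↦ c * m - ∑ i, log (t i)` on the region `0 < t i ≤ M * m`: on each
sublevel set, `m` is bounded above and the `t i` are bounded away from zero. -/
lemma exists_bounds_of_mul_sub_sum_log_le {ι : Type*} {s : Finset ι} (hs : s.Nonempty)
    {c M : ℝ} (hc : 0 < c) (hM : 0 < M) (L : ℝ) :
    ∃ C ε : ℝ, 0 < ε ∧ ∀ (m : ℝ) (t : ι → ℝ), 0 ≤ m → (∀ i ∈ s, 0 < t i ∧ t i ≤ M * m) →
      c * m - ∑ i ∈ s, Real.log (t i) ≤ L → m ≤ C ∧ ∀ i ∈ s, ε ≤ t i := by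
  classical
  have hn : (0 : ℝ) < s.card := by exact_mod_cast hs.card_pos
  set a : ℝ := c / (2 * s.card * M) with ha_def
  have ha : 0 < a := by positivity
  set C : ℝ := 2 * (L - s.card * (1 + Real.log a)) / c with hC_def
  refine ⟨C, Real.exp (-L - s.card * (M * C)), Real.exp_pos _, fun m t hm ht hL ↦ ?_⟩
  have hmC : m ≤ C := by
    have h₁ : ∑ i ∈ s, Real.log (t i) ≤ ∑ _i ∈ s, (a * (M * m) - 1 - Real.log a) := by
      refine Finset.sum_le_sum fun i hi ↦ ?_
      have h₂ := Real.log_le_sub_one_of_pos (mul_pos ha (ht i hi).1)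
      rw [Real.log_mul ha.ne' (ht i hi).1.ne'] at h₂
      have h₃ := mul_le_mul_of_nonneg_left (ht i hi).2 ha.le
      linarith
    rw [Finset.sum_const, nsmul_eq_mul] at h₁
    have h₄ : s.card * (a * (M * m)) = c * m / 2 := by
      rw [ha_def]
      field_simp
    rw [hC_def, le_div_iff₀ hc]
    linarith
  refine ⟨hmC, fun i hi ↦ ?_⟩
  rw [← Real.le_log_iff_exp_le (ht i hi).1]
  have hMC : M * m ≤ M * C := mul_le_mul_of_nonneg_left hmC hM.le
  have h₁ : ∑ j ∈ s.erase i, Real.log (t j) ≤ ∑ _j ∈ s.erase i, M * C := by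
    refine Finset.sum_le_sum fun j hj ↦ ?_
    obtain ⟨h₂, h₃⟩ := ht j (Finset.mem_of_mem_erase hj)
    linarith [Real.log_le_sub_one_of_pos h₂]
  have h₂ : ∑ _j ∈ s.erase i, M * C ≤ ∑ _j ∈ s, M * C :=
    Finset.sum_le_sum_of_subset_of_nonneg (Finset.erase_subset i s)
      fun _ _ _ ↦ mul_nonneg hM.le (hm.trans hmC)
  rw [Finset.sum_const (s := s), nsmul_eq_mul] at h₂
  have h₃ := Finset.add_sum_erase s (fun j ↦ Real.log (t j)) hi
  have h₄ : 0 ≤ c * m := by positivity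
  linarith

lemma continuous_integral_finiteMeasure {K : Type*} [TopologicalSpace K] [CompactSpace K]
    [MeasurableSpace K] [OpensMeasurableSpace K] (g : C(K, ℝ)) :
    Continuous fun μ : FiniteMeasure K ↦ ∫ x, g x ∂(μ : Measure K) :=
  FiniteMeasure.continuous_integral_boundedContinuousFunction
    (BoundedContinuousFunction.mkOfCompact g)

lemma loss_eq_lossR {K : Type*} [TopologicalSpace K] [MeasurableSpace K]
    (f : C(K, ℝ)) {Γ : Finset C(K, ℝ)} {μ : Measure K} (h : ∀ γ ∈ Γ, 0 < ∫ x, γ x ∂μ) :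
    loss f Γ μ = lossR f Γ μ :=
  if_pos h

/-- On the domain, a bound on the loss bounds the total mass from above and the integrals
`⟨μ, γ⟩` away from zero. -/
lemma exists_bounds_of_lossR_le {K : Type*} [TopologicalSpace K] [CompactSpace K]
    [MeasurableSpace K] [OpensMeasurableSpace K] (f : C(K, ℝ)) {c : ℝ} (hc : 0 < c)
    (hf : ∀ x : K, c ≤ f x) {Γ : Finset C(K, ℝ)} (hΓ : Γ.Nonempty) (L : ℝ) :
    ∃ C ε : ℝ, 0 < ε ∧ ∀ μ : FiniteMeasure K, (∀ γ ∈ Γ, 0 < ∫ x, γ x ∂(μ : Measure K)) →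
      lossR f Γ μ ≤ L → (μ.mass : ℝ) ≤ C ∧ ∀ γ ∈ Γ, ε ≤ ∫ x, γ x ∂(μ : Measure K) := by
  obtain ⟨C, ε, hε, h⟩ := exists_bounds_of_mul_sub_sum_log_le hΓ hc
    (show 0 < 1 + ∑ γ ∈ Γ, ‖γ‖ by positivity) L
  refine ⟨C, ε, hε, fun μ hμ hL ↦ ?_⟩
  have hint (g : C(K, ℝ)) : Integrable g (μ : Measure K) :=
    (BoundedContinuousFunction.mkOfCompact g).integrable _
  have hconst (r : ℝ) : ∫ _x : K, r ∂(μ : Measure K) = r * μ.mass := by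
    rw [integral_const, smul_eq_mul, mul_comm]
    rfl
  refine h μ.mass _ μ.mass.coe_nonneg (fun γ hγ ↦ ⟨hμ γ hγ, ?_⟩) (le_trans ?_ hL)
  · rw [← hconst]
    refine integral_mono (hint γ) (integrable_const _) fun x ↦ ?_
    have h₁ : γ x ≤ ‖γ‖ := (le_abs_self _).trans (γ.norm_coe_le_norm x)
    have h₂ := Finset.single_le_sum (f := fun γ : C(K, ℝ) ↦ ‖γ‖) (fun _ _ ↦ norm_nonneg _) hγ
    simp only at h₂ ⊢
    linarith
  · rw [lossR, ← hconst]
    exact sub_le_sub_right (integral_mono (integrable_const _) (hint f) hf) _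

/-- The infimum of the loss is a minimum. -/
theorem stmt3 {K : Type*} [MetricSpace K] [CompactSpace K] [Nonempty K]
    [MeasurableSpace K] [BorelSpace K]
    (f : C(K, ℝ)) (c : ℝ) (hc : 0 < c) (hf : ∀ x : K, c ≤ f x)
    (Γ : Finset C(K, ℝ)) (hΓ : Γ.Nonempty) (hΓpos : ∀ γ ∈ Γ, ∀ x : K, 0 ≤ γ x)
    (hdomne : ∃ μ : Measure K, IsFiniteMeasure μ ∧ ∀ γ ∈ Γ, 0 < ∫ x, γ x ∂μ) :
    ∃ μs : Measure K, IsFiniteMeasure μs ∧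
      ∀ ν : Measure K, IsFiniteMeasure ν → loss f Γ μs ≤ loss f Γ ν := by
  obtain ⟨μ₀, hμ₀, hdom₀⟩ := hdomne
  obtain ⟨C, ε, hε, hbound⟩ := exists_bounds_of_lossR_le f hc hf hΓ (lossR f Γ μ₀)
  let S : Set (FiniteMeasure K) := {μ | μ.mass ≤ C.toNNReal} ∩
    {μ | ∀ γ ∈ Γ, ε ≤ ∫ x, γ x ∂(μ : Measure K)}
  have hmemS (μ : FiniteMeasure K) (hμ : ∀ γ ∈ Γ, 0 < ∫ x, γ x ∂(μ : Measure K))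
      (hL : lossR f Γ μ ≤ lossR f Γ μ₀) : μ ∈ S :=
    ⟨NNReal.le_toNNReal_of_coe_le (hbound μ hμ hL).1, (hbound μ hμ hL).2⟩
  have hScomp : IsCompact S := by
    refine (isCompact_setOfPred_finiteMeasure_le_of_compactSpace K _).inter_right ?_
    simp only [Set.ofPred_forall]
    exact isClosed_biInter fun γ _ ↦
      isClosed_le continuous_const (continuous_integral_finiteMeasure γ)
  have hcont : ContinuousOn (fun μ : FiniteMeasure K ↦ lossR f Γ μ) S := by
    refine (continuous_integral_finiteMeasure f).continuousOn.sub
      (continuousOn_finsetSum _ fun γ hγ ↦ ?_)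
    exact (continuous_integral_finiteMeasure γ).continuousOn.log
      fun μ hμ ↦ (hε.trans_le (hμ.2 γ hγ)).ne'
  have hμ₀S : (⟨μ₀, hμ₀⟩ : FiniteMeasure K) ∈ S := hmemS ⟨μ₀, hμ₀⟩ hdom₀ le_rfl
  obtain ⟨μs, hμsS, hmin⟩ := hScomp.exists_isMinOn ⟨_, hμ₀S⟩ hcont
  refine ⟨μs, inferInstance, fun ν hν ↦ ?_⟩
  rw [loss_eq_lossR f fun γ hγ ↦ hε.trans_le (hμsS.2 γ hγ)]
  by_cases hdom : ∀ γ ∈ Γ, 0 < ∫ x, γ x ∂ν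
  · rw [loss_eq_lossR f hdom, EReal.coe_le_coe_iff]
    rcases le_total (lossR f Γ ν) (lossR f Γ μ₀) with hle | hle
    · exact hmin (hmemS ⟨ν, hν⟩ hdom hle)
    · exact (hmin hμ₀S).trans hle
  · rw [loss, if_neg hdom]
    exact le_top
end

section
/- Any minimizer μ* ∈ dom(ℓ) of ℓ over M_+(K) satisfies ⟨μ*, f⟩ = n, and consequently its total mass satisfies μ*(K) ≤ n/c. Hence minimizing ℓ over M_+(K) is equivalent to minimizing ℓ over the set {μ ∈ M_+(K) : ⟨μ, f⟩ = n}. -/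
open MeasureTheory Filter

theorem integrable_continuousMap {K : Type*} [TopologicalSpace K] [CompactSpace K]
    [MeasurableSpace K] [BorelSpace K]
    (g : C(K, ℝ)) (ν : Measure K) [IsFiniteMeasure ν] :
    Integrable (fun x => g x) ν :=
  g.continuous.integrable_of_hasCompactSupport
    (HasCompactSupport.of_compactSpace _)

theorem mul_mass_le_integral {K : Type*} [TopologicalSpace K] [CompactSpace K]
    [MeasurableSpace K] [BorelSpace K]
    {f : C(K, ℝ)} {c : ℝ} (hf : ∀ x, c ≤ f x)
    (ν : Measure K) [IsFiniteMeasure ν] :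
    c * (ν Set.univ).toReal ≤ ∫ x, f x ∂ν := by
  have h := integral_mono (integrable_const c) (integrable_continuousMap f ν) hf
  simpa [Measure.real, mul_comm] using h

theorem integral_pos_of_mem_dom {K : Type*} [TopologicalSpace K] [CompactSpace K]
    [MeasurableSpace K] [BorelSpace K]
    {f : C(K, ℝ)} {c : ℝ} (hc : 0 < c) (hf : ∀ x, c ≤ f x)
    {γ : C(K, ℝ)} (ν : Measure K) [IsFiniteMeasure ν] (hγ : 0 < ∫ x, γ x ∂ν) :
    0 < ∫ x, f x ∂ν := by
  have hν : ν Set.univ ≠ 0 := by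
    intro h
    rw [Measure.measure_univ_eq_zero.mp h, integral_zero_measure] at hγ
    exact lt_irrefl _ hγ
  exact (mul_pos hc (ENNReal.toReal_pos hν (measure_ne_top ν _))).trans_le
    (mul_mass_le_integral hf ν)

/-- Scaling a measure of the domain so that the integral of `f` becomes `#Γ` keeps it in the
domain and changes the loss by an explicit amount. -/
theorem exists_rescaled_loss_eq {K : Type*} [TopologicalSpace K] [MeasurableSpace K]
    (f : C(K, ℝ)) {Γ : Finset C(K, ℝ)} (hΓ : Γ.Nonempty)
    (ν : Measure K) [IsFiniteMeasure ν] (hdom : ∀ γ ∈ Γ, 0 < ∫ x, γ x ∂ν)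
    (ha : 0 < ∫ x, f x ∂ν) :
    ∃ ν' : Measure K, IsFiniteMeasure ν' ∧ (∫ x, f x ∂ν') = (Γ.card : ℝ) ∧
      loss f Γ ν' = ((Γ.card + Γ.card * Real.log ((∫ x, f x ∂ν) / Γ.card)
        - ∑ γ ∈ Γ, Real.log (∫ x, γ x ∂ν) : ℝ) : EReal) := by
  set a := ∫ x, f x ∂ν
  have hn : (0 : ℝ) < Γ.card := by exact_mod_cast hΓ.card_pos
  have ht : 0 < (Γ.card : ℝ) / a := div_pos hn ha
  have hint : ∀ g : C(K, ℝ),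
      ∫ x, g x ∂(ENNReal.ofReal (Γ.card / a) • ν) = Γ.card / a * ∫ x, g x ∂ν := by
    intro g
    rw [integral_smul_measure, ENNReal.toReal_ofReal ht.le, smul_eq_mul]
  have hfn : ∫ x, f x ∂(ENNReal.ofReal (Γ.card / a) • ν) = Γ.card := by
    rw [hint]
    exact div_mul_cancel₀ _ ha.ne'
  refine ⟨ENNReal.ofReal (Γ.card / a) • ν, ν.smul_finite ENNReal.ofReal_ne_top, hfn, ?_⟩
  have hlog : ∑ γ ∈ Γ, Real.log (∫ x, γ x ∂(ENNReal.ofReal (Γ.card / a) • ν)) =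
      ∑ γ ∈ Γ, Real.log (∫ x, γ x ∂ν) - Γ.card * Real.log (a / Γ.card) := by
    have hterm : ∀ γ ∈ Γ, Real.log (∫ x, γ x ∂(ENNReal.ofReal (Γ.card / a) • ν)) =
        Real.log (∫ x, γ x ∂ν) - Real.log (a / Γ.card) := by
      intro γ hγ
      rw [hint, Real.log_mul ht.ne' (hdom γ hγ).ne', ← inv_div, Real.log_inv]
      ring
    rw [Finset.sum_congr rfl hterm, Finset.sum_sub_distrib, Finset.sum_const, nsmul_eq_mul]
  rw [loss, if_pos fun γ hγ => by rw [hint]; exact mul_pos ht (hdom γ hγ), hfn, hlog]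
  congr 1
  ring

/-- Any minimizer in the domain has `⟨μ*, f⟩ = n` and mass at most `n/c`; minimizing over
all of `M₊(K)` is equivalent to minimizing over the set `{μ : ⟨μ, f⟩ = n}`. -/
theorem stmt4 {K : Type*} [MetricSpace K] [CompactSpace K] [Nonempty K]
    [MeasurableSpace K] [BorelSpace K]
    (f : C(K, ℝ)) (c : ℝ) (hc : 0 < c) (hf : ∀ x : K, c ≤ f x)
    (Γ : Finset C(K, ℝ)) (hΓ : Γ.Nonempty) (hΓpos : ∀ γ ∈ Γ, ∀ x : K, 0 ≤ γ x)
    (μs : Measure K) [IsFiniteMeasure μs] (hdom : ∀ γ ∈ Γ, 0 < ∫ x, γ x ∂μs) :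
    ((∀ ν : Measure K, IsFiniteMeasure ν → loss f Γ μs ≤ loss f Γ ν) →
      ((∫ x, f x ∂μs) = (Γ.card : ℝ) ∧ (μs Set.univ).toReal ≤ (Γ.card : ℝ) / c)) ∧
    ((∀ ν : Measure K, IsFiniteMeasure ν → loss f Γ μs ≤ loss f Γ ν) ↔
      ((∫ x, f x ∂μs) = (Γ.card : ℝ) ∧
        ∀ ν : Measure K, IsFiniteMeasure ν → (∫ x, f x ∂ν) = (Γ.card : ℝ) →
          loss f Γ μs ≤ loss f Γ ν)) := by
  have hn : (0 : ℝ) < Γ.card := by exact_mod_cast hΓ.card_pos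
  obtain ⟨γ₀, hγ₀⟩ := hΓ
  have key : (∀ ν : Measure K, IsFiniteMeasure ν → loss f Γ μs ≤ loss f Γ ν) →
      (∫ x, f x ∂μs) = (Γ.card : ℝ) := by
    intro hmin
    have ha := integral_pos_of_mem_dom hc hf μs (hdom γ₀ hγ₀)
    obtain ⟨ν', hν', -, hloss⟩ := exists_rescaled_loss_eq f ⟨γ₀, hγ₀⟩ μs hdom ha
    have hle := hmin ν' hν'
    rw [hloss, loss, if_pos hdom, EReal.coe_le_coe_iff] at hle
    by_contra hne
    have hlt := mul_lt_mul_of_pos_left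
      (Real.log_lt_sub_one_of_pos (div_pos ha hn) (fun h => hne ((div_eq_one_iff_eq hn.ne').mp h)))
      hn
    rw [mul_sub, mul_div_cancel₀ _ hn.ne'] at hlt
    linarith
  refine ⟨fun hmin => ⟨key hmin, ?_⟩, fun hmin => ⟨key hmin, fun ν hν _ => hmin ν hν⟩, ?_⟩
  · rw [le_div_iff₀ hc, mul_comm, ← key hmin]
    exact mul_mass_le_integral hf μs
  · rintro ⟨-, hmin⟩ ν hν
    by_cases hdν : ∀ γ ∈ Γ, 0 < ∫ x, γ x ∂ν
    · have ha := integral_pos_of_mem_dom hc hf ν (hdν γ₀ hγ₀)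
      obtain ⟨ν', hν', hfn, hloss⟩ := exists_rescaled_loss_eq f ⟨γ₀, hγ₀⟩ ν hdν ha
      refine (hmin ν' hν' hfn).trans ?_
      rw [hloss, loss, if_pos hdν, EReal.coe_le_coe_iff]
      have hle := mul_le_mul_of_nonneg_left (Real.log_le_sub_one_of_pos (div_pos ha hn)) hn.le
      rw [mul_sub, mul_div_cancel₀ _ hn.ne'] at hle
      linarith
    · rw [loss.eq_def f Γ ν, if_neg hdν]
      exact le_top
end

section
/- Any minimizer μ* ∈ dom(ℓ) of ℓ over M_+(K) has its topological support contained in K̃ := ⋃_{γ∈Γ} supp(γ). -/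
open MeasureTheory Filter

/-- If all `γ ∈ Γ` vanish outside a measurable set `F` and restricting `μ` to `F` does not decrease
the loss, then `μ` gives no mass to the complement of `F`. -/
theorem measure_compl_eq_zero_of_loss_le {K : Type*} [MetricSpace K] [CompactSpace K]
    [MeasurableSpace K] [BorelSpace K]
    (f : C(K, ℝ)) (c : ℝ) (hc : 0 < c) (hf : ∀ x : K, c ≤ f x) (Γ : Finset C(K, ℝ))
    (μ : Measure K) [IsFiniteMeasure μ] (hdom : ∀ γ ∈ Γ, 0 < ∫ x, γ x ∂μ)
    {F : Set K} (hF : MeasurableSet F) (hΓF : ∀ γ ∈ Γ, ∀ x ∉ F, γ x = 0)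
    (hle : loss f Γ μ ≤ loss f Γ (μ.restrict F)) : μ Fᶜ = 0 := by
  have hγ : ∀ γ ∈ Γ, ∫ x in F, γ x ∂μ = ∫ x, γ x ∂μ := fun γ h =>
    setIntegral_eq_integral_of_forall_compl_eq_zero (hΓF γ h)
  have hdomF : ∀ γ ∈ Γ, 0 < ∫ x in F, γ x ∂μ := fun γ h => (hγ γ h).symm ▸ hdom γ h
  have hint : Integrable (fun x => f x) μ :=
    f.continuous.integrable_of_hasCompactSupport (HasCompactSupport.of_compactSpace _)
  rw [loss, loss, if_pos hdom, if_pos hdomF, EReal.coe_le_coe_iff,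
    Finset.sum_congr rfl fun γ h => congrArg Real.log (hγ γ h)] at hle
  have hsplit := integral_add_compl hF hint
  have hlow : c * μ.real Fᶜ ≤ ∫ x in Fᶜ, f x ∂μ :=
    setIntegral_ge_of_const_le_real hF.compl (measure_ne_top μ _) (fun x _ => hf x)
      hint.integrableOn
  have hzero : μ.real Fᶜ = 0 := by
    nlinarith [measureReal_nonneg (μ := μ) (s := Fᶜ)]
  exact (measureReal_eq_zero_iff).mp hzero

/-- Any minimizer in the domain is supported in `K̃ = ⋃_{γ ∈ Γ} supp γ`. -/
theorem stmt5 {K : Type*} [MetricSpace K] [CompactSpace K] [Nonempty K]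
    [MeasurableSpace K] [BorelSpace K]
    (f : C(K, ℝ)) (c : ℝ) (hc : 0 < c) (hf : ∀ x : K, c ≤ f x)
    (Γ : Finset C(K, ℝ)) (hΓ : Γ.Nonempty) (hΓpos : ∀ γ ∈ Γ, ∀ x : K, 0 ≤ γ x)
    (μs : Measure K) [IsFiniteMeasure μs] (hdom : ∀ γ ∈ Γ, 0 < ∫ x, γ x ∂μs)
    (hmin : ∀ ν : Measure K, IsFiniteMeasure ν → loss f Γ μs ≤ loss f Γ ν) :
    msupport μs ⊆ ⋃ γ ∈ Γ, tsupport ⇑γ := by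
  have hclosed : IsClosed (⋃ γ ∈ Γ, tsupport ⇑γ) :=
    Γ.finite_toSet.isClosed_biUnion fun γ _ => isClosed_tsupport _
  intro x hx
  by_contra hxF
  refine hx _ hxF hclosed.isOpen_compl ?_
  refine measure_compl_eq_zero_of_loss_le f c hc hf Γ μs hdom hclosed.measurableSet
    (fun γ hγ y hy => ?_) (hmin _ inferInstance)
  exact image_eq_zero_of_notMem_tsupport fun h => hy (Set.mem_biUnion hγ h)
end

section
/- For every μ ∈ dom(ℓ), the total mass of the ML-EM update is bounded: T(μ)(K) ≤ n/c. Consequently the sequence of ML-EM iterates (μ_k)_{k≥1} started from any μ_0 ∈ dom(ℓ) is bounded in total variation by n/c. -/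
open MeasureTheory Filter

/-- The total mass of the ML-EM update of a finite measure is at most `n/c`. No domain condition
is needed, since the terms with `∫ γ ∂μ = 0` vanish by the convention on division by zero. -/
theorem mlem_univ_le {K : Type*} [TopologicalSpace K] [CompactSpace K]
    [MeasurableSpace K] [BorelSpace K]
    (f : C(K, ℝ)) {c : ℝ} (hc : 0 < c) (hf : ∀ x : K, c ≤ f x)
    (Γ : Finset C(K, ℝ)) (hΓpos : ∀ γ ∈ Γ, ∀ x : K, 0 ≤ γ x)
    (μ : Measure K) [IsFiniteMeasure μ] :
    (mlem f Γ μ) Set.univ ≤ ENNReal.ofReal ((Γ.card : ℝ) / c) := by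
  have hint (γ : C(K, ℝ)) : Integrable (fun x => γ x / ∫ y, γ y ∂μ) μ :=
    (γ.continuous.integrable_of_hasCompactSupport
      (HasCompactSupport.of_compactSpace γ)).div_const _
  have hnn (x : K) : 0 ≤ ∑ γ ∈ Γ, γ x / ∫ y, γ y ∂μ :=
    Finset.sum_nonneg fun γ hγ => div_nonneg (hΓpos γ hγ x) (integral_nonneg (hΓpos γ hγ))
  calc (mlem f Γ μ) Set.univ
      = ∫⁻ x, ENNReal.ofReal ((f x)⁻¹ * ∑ γ ∈ Γ, γ x / ∫ y, γ y ∂μ) ∂μ := by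
        rw [mlem, withDensity_apply _ MeasurableSet.univ, setLIntegral_univ]
    _ ≤ ∫⁻ x, ENNReal.ofReal (c⁻¹ * ∑ γ ∈ Γ, γ x / ∫ y, γ y ∂μ) ∂μ :=
        lintegral_mono fun x => ENNReal.ofReal_le_ofReal
          (mul_le_mul_of_nonneg_right (inv_anti₀ hc (hf x)) (hnn x))
    _ = ENNReal.ofReal (∫ x, c⁻¹ * ∑ γ ∈ Γ, γ x / ∫ y, γ y ∂μ ∂μ) :=
        (ofReal_integral_eq_lintegral_ofReal
          ((integrable_finsetSum _ fun γ _ => hint γ).const_mul _)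
          (ae_of_all _ fun x => mul_nonneg (inv_nonneg.2 hc.le) (hnn x))).symm
    _ ≤ ENNReal.ofReal ((Γ.card : ℝ) / c) := by
        refine ENNReal.ofReal_le_ofReal ?_
        rw [integral_const_mul, integral_finsetSum _ fun γ _ => hint γ, div_eq_inv_mul]
        refine mul_le_mul_of_nonneg_left ?_ (inv_nonneg.2 hc.le)
        simp_rw [integral_div]
        simpa using Finset.sum_le_card_nsmul Γ _ 1 fun γ _ => div_self_le_one (∫ x, γ x ∂μ)

/-- The total mass of the ML-EM update is bounded by `n/c`. -/
theorem stmt8 {K : Type*} [MetricSpace K] [CompactSpace K] [Nonempty K]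
    [MeasurableSpace K] [BorelSpace K]
    (f : C(K, ℝ)) (c : ℝ) (hc : 0 < c) (hf : ∀ x : K, c ≤ f x)
    (Γ : Finset C(K, ℝ)) (hΓ : Γ.Nonempty) (hΓpos : ∀ γ ∈ Γ, ∀ x : K, 0 ≤ γ x)
    (μ : Measure K) [IsFiniteMeasure μ] (hdom : ∀ γ ∈ Γ, 0 < ∫ x, γ x ∂μ)
    (μseq : ℕ → Measure K) (hfin0 : IsFiniteMeasure (μseq 0))
    (hdom0 : ∀ γ ∈ Γ, 0 < ∫ x, γ x ∂(μseq 0))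
    (hrec : ∀ k : ℕ, μseq (k + 1) = mlem f Γ (μseq k)) :
    (mlem f Γ μ) Set.univ ≤ ENNReal.ofReal ((Γ.card : ℝ) / c) ∧
    ∀ k : ℕ, 1 ≤ k → (μseq k) Set.univ ≤ ENNReal.ofReal ((Γ.card : ℝ) / c) := by
  have hfin (k : ℕ) : IsFiniteMeasure (μseq k) := by
    induction k with
    | zero => exact hfin0
    | succ k ih =>
      rw [hrec k]
      exact ⟨(mlem_univ_le f hc hf Γ hΓpos (μseq k)).trans_lt ENNReal.ofReal_lt_top⟩
  refine ⟨mlem_univ_le f hc hf Γ hΓpos μ, fun k hk => ?_⟩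
  obtain ⟨m, rfl⟩ := Nat.exists_eq_add_of_le' hk
  have := hfin m
  rw [hrec m]
  exact mlem_univ_le f hc hf Γ hΓpos (μseq m)
end

section
/- If μ_0 ∈ dom(ℓ) has topological support equal to all of K, then for every k ≥ 1 the ML-EM iterate μ_k = T^k(μ_0) has topological support exactly K̃ := ⋃_{γ∈Γ} supp(γ). -/
open MeasureTheory Filter

section MLEM

variable {K : Type*} [TopologicalSpace K] [MeasurableSpace K]

theorem continuous_mlem_density (f : C(K, ℝ)) (hf : ∀ x, 0 < f x) (Γ : Finset C(K, ℝ))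
    (μ : Measure K) :
    Continuous fun x => (f x)⁻¹ * ∑ γ ∈ Γ, γ x / (∫ y, γ y ∂μ) :=
  (f.continuous.inv₀ fun x => (hf x).ne').mul
    (continuous_finsetSum Γ fun γ _ => γ.continuous.div_const _)

theorem mlem_density_pos_iff {f : C(K, ℝ)} (hf : ∀ x, 0 < f x) {Γ : Finset C(K, ℝ)}
    (hΓ : ∀ γ ∈ Γ, ∀ x, 0 ≤ γ x) {μ : Measure K} (hμ : ∀ γ ∈ Γ, 0 < ∫ x, γ x ∂μ) (x : K) :
    0 < (f x)⁻¹ * ∑ γ ∈ Γ, γ x / (∫ y, γ y ∂μ) ↔ ∃ γ ∈ Γ, γ x ≠ 0 := by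
  rw [mul_pos_iff_of_pos_left (inv_pos.2 (hf x)),
    Finset.sum_pos_iff_of_nonneg fun γ hγ => div_nonneg (hΓ γ hγ x) (hμ γ hγ).le]
  refine exists_congr fun γ => and_congr_right fun hγ => ?_
  rw [div_pos_iff_of_pos_right (hμ γ hγ)]
  exact (hΓ γ hγ x).lt_iff_ne'

theorem mlem_apply_eq_zero_iff [OpensMeasurableSpace K] {f : C(K, ℝ)} (hf : ∀ x, 0 < f x)
    {Γ : Finset C(K, ℝ)} (hΓ : ∀ γ ∈ Γ, ∀ x, 0 ≤ γ x) {μ : Measure K}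
    (hμ : ∀ γ ∈ Γ, 0 < ∫ x, γ x ∂μ) (s : Set K) :
    mlem f Γ μ s = 0 ↔ μ ({x | ∃ γ ∈ Γ, γ x ≠ 0} ∩ s) = 0 := by
  rw [mlem, withDensity_apply_eq_zero
    (continuous_mlem_density f hf Γ μ).measurable.ennreal_ofReal]
  simp only [ne_eq, ENNReal.ofReal_eq_zero, not_le, mlem_density_pos_iff hf hΓ hμ]

theorem isFiniteMeasure_mlem [CompactSpace K] [OpensMeasurableSpace K] {f : C(K, ℝ)}
    (hf : ∀ x, 0 < f x) (Γ : Finset C(K, ℝ)) (μ : Measure K) [IsFiniteMeasure μ] :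
    IsFiniteMeasure (mlem f Γ μ) :=
  isFiniteMeasure_withDensity_ofReal
    ((continuous_mlem_density f hf Γ μ).integrable_of_hasCompactSupport
      (HasCompactSupport.of_compactSpace _)).2

theorem integral_pos_of_mem_msupport [CompactSpace K] [OpensMeasurableSpace K] {γ : C(K, ℝ)}
    (hγ : ∀ x, 0 ≤ γ x) {μ : Measure K} [IsFiniteMeasure μ] {x : K} (hx : γ x ≠ 0)
    (hxμ : x ∈ msupport μ) : 0 < ∫ x, γ x ∂μ := by
  rw [integral_pos_iff_support_of_nonneg hγ
    (γ.continuous.integrable_of_hasCompactSupport (HasCompactSupport.of_compactSpace _))]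
  exact pos_iff_ne_zero.2 (hxμ _ hx γ.continuous.isOpen_support)

theorem mem_msupport_mlem [OpensMeasurableSpace K] {f : C(K, ℝ)} (hf : ∀ x, 0 < f x)
    {Γ : Finset C(K, ℝ)} (hΓ : ∀ γ ∈ Γ, ∀ x, 0 ≤ γ x) {μ : Measure K}
    (hμ : ∀ γ ∈ Γ, 0 < ∫ x, γ x ∂μ) {γ : C(K, ℝ)} (hγ : γ ∈ Γ) {x : K} (hx : γ x ≠ 0)
    (hxμ : x ∈ msupport μ) : x ∈ msupport (mlem f Γ μ) := by
  intro U hxU hU h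
  rw [mlem_apply_eq_zero_iff hf hΓ hμ] at h
  refine hxμ (Function.support γ ∩ U) ⟨hx, hxU⟩ (γ.continuous.isOpen_support.inter hU)
    (measure_mono_null ?_ h)
  exact Set.inter_subset_inter_left U fun y hy => ⟨γ, hγ, hy⟩

theorem msupport_mlem [OpensMeasurableSpace K] {f : C(K, ℝ)} (hf : ∀ x, 0 < f x)
    {Γ : Finset C(K, ℝ)} (hΓ : ∀ γ ∈ Γ, ∀ x, 0 ≤ γ x) {μ : Measure K}
    (hμ : ∀ γ ∈ Γ, 0 < ∫ x, γ x ∂μ) (hsupp : ∀ γ ∈ Γ, ∀ x, γ x ≠ 0 → x ∈ msupport μ) :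
    msupport (mlem f Γ μ) = ⋃ γ ∈ Γ, tsupport ⇑γ := by
  apply Set.Subset.antisymm
  · intro x hx
    by_contra hxK
    refine hx (⋃ γ ∈ Γ, tsupport ⇑γ)ᶜ hxK
      (Γ.finite_toSet.isClosed_biUnion fun γ _ => isClosed_tsupport γ).isOpen_compl ?_
    rw [mlem_apply_eq_zero_iff hf hΓ hμ]
    convert measure_empty (μ := μ)
    refine Set.eq_empty_of_forall_notMem ?_
    rintro y ⟨⟨γ, hγ, hy⟩, hyK⟩
    exact hyK (Set.mem_biUnion hγ (subset_tsupport γ hy))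
  · refine Set.iUnion₂_subset fun γ hγ x hx U hxU hU => ?_
    obtain ⟨y, hyU, hy⟩ := mem_closure_iff.1 hx U hU hxU
    exact mem_msupport_mlem hf hΓ hμ hγ hy (hsupp γ hγ y hy) U hyU hU

end MLEM

/-- If the initial measure has full support, all further iterates have support `K̃`. -/
theorem stmt9 {K : Type*} [MetricSpace K] [CompactSpace K] [Nonempty K]
    [MeasurableSpace K] [BorelSpace K]
    (f : C(K, ℝ)) (c : ℝ) (hc : 0 < c) (hf : ∀ x : K, c ≤ f x)
    (Γ : Finset C(K, ℝ)) (hΓ : Γ.Nonempty) (hΓpos : ∀ γ ∈ Γ, ∀ x : K, 0 ≤ γ x)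
    (μ0 : Measure K) [IsFiniteMeasure μ0] (hdom0 : ∀ γ ∈ Γ, 0 < ∫ x, γ x ∂μ0)
    (hsupp0 : msupport μ0 = Set.univ)
    (μseq : ℕ → Measure K) (h0 : μseq 0 = μ0)
    (hrec : ∀ k : ℕ, μseq (k + 1) = mlem f Γ (μseq k)) :
    ∀ k : ℕ, 1 ≤ k → msupport (μseq k) = ⋃ γ ∈ Γ, tsupport ⇑γ := by
  have hf' : ∀ x, 0 < f x := fun x => hc.trans_le (hf x)
  have key : ∀ k, IsFiniteMeasure (μseq k) ∧ (∀ γ ∈ Γ, 0 < ∫ x, γ x ∂μseq k) ∧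
      ∀ γ ∈ Γ, ∀ x, γ x ≠ 0 → x ∈ msupport (μseq k) := by
    intro k
    induction k with
    | zero =>
      rw [h0]
      exact ⟨inferInstance, hdom0, fun γ _ x _ => hsupp0 ▸ Set.mem_univ x⟩
    | succ k ih =>
      obtain ⟨_, hdom, hsupp⟩ := ih
      have hfin := isFiniteMeasure_mlem hf' Γ (μseq k)
      have hsupp' : ∀ γ ∈ Γ, ∀ x, γ x ≠ 0 → x ∈ msupport (mlem f Γ (μseq k)) :=
        fun γ hγ x hx => mem_msupport_mlem hf' hΓpos hdom hγ hx (hsupp γ hγ x hx)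
      rw [hrec]
      refine ⟨hfin, fun γ hγ => ?_, hsupp'⟩
      obtain ⟨x, hx⟩ : ∃ x, γ x ≠ 0 := by
        by_contra! h
        simpa [h] using hdom γ hγ
      exact integral_pos_of_mem_msupport (hΓpos γ hγ) hx (hsupp' γ hγ x hx)
  intro k hk
  obtain ⟨k, rfl⟩ := Nat.exists_eq_add_of_le' hk
  rw [hrec]
  exact msupport_mlem hf' hΓpos (key k).2.1 (key k).2.2
end

section
/- Let μ_k ∈ dom(ℓ) and μ_{k+1} = T(μ_k). Then Q_k(μ_k) − Q_k(μ_{k+1}) = D(f·μ_{k+1} ‖ f·μ_k), where f·ν denotes the measure with density f with respect to ν. -/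
open MeasureTheory Filter

/-- The density of `mlem f Γ μ` with respect to `μ`. -/
noncomputable def mlemDensity {K : Type*} [TopologicalSpace K] [MeasurableSpace K]
    (f : C(K, ℝ)) (Γ : Finset C(K, ℝ)) (μ : Measure K) (x : K) : ℝ :=
  (f x)⁻¹ * ∑ γ ∈ Γ, γ x / (∫ y, γ y ∂μ)

lemma KL_withDensity_ofReal {K : Type*} [MeasurableSpace K] (μ : Measure K) [SigmaFinite μ]
    {a b : K → ℝ} (ha : Measurable a) (hb : Measurable b) (ha0 : ∀ x, 0 ≤ a x)
    (hb0 : ∀ x, 0 ≤ b x) (hab : ∀ x, b x = 0 → a x = 0) :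
    KL (μ.withDensity (fun x => ENNReal.ofReal (a x)))
      (μ.withDensity (fun x => ENNReal.ofReal (b x))) =
      ∫ x, a x * Real.log (a x / b x) ∂μ := by
  have hac : μ.withDensity (fun x => ENNReal.ofReal (a x)) =
      (μ.withDensity (fun x => ENNReal.ofReal (b x))).withDensity
        (fun x => ENNReal.ofReal (a x / b x)) := by
    rw [← withDensity_mul _ (by fun_prop) (by fun_prop)]
    congr 1
    ext x
    rw [Pi.mul_apply, ← ENNReal.ofReal_mul (hb0 x), mul_div_cancel_of_imp' (hab x)]
  have : SigmaFinite (μ.withDensity (fun x => ENNReal.ofReal (b x))) :=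
    SigmaFinite.withDensity_ofReal _
  have hrn : (μ.withDensity (fun x => ENNReal.ofReal (a x))).rnDeriv
      (μ.withDensity (fun x => ENNReal.ofReal (b x)))
      =ᵐ[μ.withDensity (fun x => ENNReal.ofReal (a x))]
      fun x => ENNReal.ofReal (a x / b x) := by
    rw [hac]
    exact (withDensity_absolutelyContinuous _ _).ae_le
      (Measure.rnDeriv_withDensity _ (by fun_prop))
  unfold KL
  rw [integral_congr_ae (g := fun x => Real.log (a x / b x)),
    integral_withDensity_eq_integral_toReal_smul (by fun_prop) (by simp)]
  · simp [ENNReal.toReal_ofReal, ha0]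
  · filter_upwards [hrn] with x hx
    rw [hx, ENNReal.toReal_ofReal (div_nonneg (ha0 x) (hb0 x))]

section MLEM

variable {K : Type*} [TopologicalSpace K] [MeasurableSpace K]
  {f : C(K, ℝ)} {Γ : Finset C(K, ℝ)} {μ : Measure K}

lemma continuous_mlemDensity (hf : ∀ x, 0 < f x) : Continuous (mlemDensity f Γ μ) := by
  unfold mlemDensity
  exact (f.continuous.inv₀ fun x => (hf x).ne').mul
    (continuous_finsetSum _ fun γ _ => γ.continuous.div_const _)

lemma mlemDensity_nonneg (hf : ∀ x, 0 < f x) (hΓ : ∀ γ ∈ Γ, ∀ x, 0 ≤ γ x)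
    (hdom : ∀ γ ∈ Γ, 0 < ∫ x, γ x ∂μ) (x : K) : 0 ≤ mlemDensity f Γ μ x :=
  mul_nonneg (inv_nonneg.2 (hf x).le)
    (Finset.sum_nonneg fun γ hγ => div_nonneg (hΓ γ hγ x) (hdom γ hγ).le)

lemma mul_mlemDensity (hf : ∀ x, 0 < f x) (x : K) :
    f x * mlemDensity f Γ μ x = ∑ γ ∈ Γ, γ x / (∫ y, γ y ∂μ) :=
  mul_inv_cancel_left₀ (hf x).ne' _

lemma div_integral_le_mul_mlemDensity (hf : ∀ x, 0 < f x) (hΓ : ∀ γ ∈ Γ, ∀ x, 0 ≤ γ x)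
    (hdom : ∀ γ ∈ Γ, 0 < ∫ x, γ x ∂μ) {γ : C(K, ℝ)} (hγ : γ ∈ Γ) (x : K) :
    γ x / (∫ y, γ y ∂μ) ≤ f x * mlemDensity f Γ μ x := by
  rw [mul_mlemDensity hf]
  exact Finset.single_le_sum (f := fun γ : C(K, ℝ) => γ x / (∫ y, γ y ∂μ))
    (fun γ hγ => div_nonneg (hΓ γ hγ x) (hdom γ hγ).le) hγ

lemma eq_zero_of_mlemDensity_eq_zero (hf : ∀ x, 0 < f x) (hΓ : ∀ γ ∈ Γ, ∀ x, 0 ≤ γ x)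
    (hdom : ∀ γ ∈ Γ, 0 < ∫ x, γ x ∂μ) {γ : C(K, ℝ)} (hγ : γ ∈ Γ) {x : K}
    (hx : mlemDensity f Γ μ x = 0) : γ x = 0 := by
  have h := div_integral_le_mul_mlemDensity hf hΓ hdom hγ x
  rw [hx, mul_zero, div_le_iff₀ (hdom γ hγ), zero_mul] at h
  exact le_antisymm h (hΓ γ hγ x)

lemma integral_div_integral {γ : C(K, ℝ)} (hγ : 0 < ∫ x, γ x ∂μ) :
    ∫ x, γ x / (∫ y, γ y ∂μ) ∂μ = 1 := by
  rw [integral_div, div_self hγ.ne']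

variable [BorelSpace K]

lemma integral_mlem (hf : ∀ x, 0 < f x) (hΓ : ∀ γ ∈ Γ, ∀ x, 0 ≤ γ x)
    (hdom : ∀ γ ∈ Γ, 0 < ∫ x, γ x ∂μ) (h : K → ℝ) :
    ∫ x, h x ∂(mlem f Γ μ) = ∫ x, mlemDensity f Γ μ x * h x ∂μ := by
  have hm : Measurable (mlemDensity f Γ μ) := (continuous_mlemDensity hf).measurable
  change ∫ x, h x ∂(μ.withDensity fun x => ENNReal.ofReal (mlemDensity f Γ μ x)) = _
  rw [integral_withDensity_eq_integral_toReal_smul (by fun_prop) (by simp)]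
  simp [ENNReal.toReal_ofReal, mlemDensity_nonneg hf hΓ hdom]

lemma withDensity_mlem (hf : ∀ x, 0 < f x) (hΓ : ∀ γ ∈ Γ, ∀ x, 0 ≤ γ x)
    (hdom : ∀ γ ∈ Γ, 0 < ∫ x, γ x ∂μ) {h : K → ℝ} (hh : Measurable h) :
    (mlem f Γ μ).withDensity (fun x => ENNReal.ofReal (h x)) =
      μ.withDensity (fun x => ENNReal.ofReal (mlemDensity f Γ μ x * h x)) := by
  have hm : Measurable (mlemDensity f Γ μ) := (continuous_mlemDensity hf).measurable
  change (μ.withDensity fun x => ENNReal.ofReal (mlemDensity f Γ μ x)).withDensity _ = _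
  rw [← withDensity_mul _ (by fun_prop) (by fun_prop)]
  congr 1
  ext x
  rw [Pi.mul_apply, ENNReal.ofReal_mul (mlemDensity_nonneg hf hΓ hdom x)]

lemma KL_nug_self [IsFiniteMeasure μ] {γ : C(K, ℝ)} (hγ : ∀ x, 0 ≤ γ x) :
    KL (nug γ μ) (nug γ μ) = 0 := by
  have hm : Measurable γ := γ.continuous.measurable
  have h0 (x : K) : 0 ≤ γ x / ∫ y, γ y ∂μ := div_nonneg (hγ x) (integral_nonneg hγ)
  unfold nug
  rw [KL_withDensity_ofReal μ (by fun_prop) (by fun_prop) h0 h0 fun _ => id]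
  refine (integral_congr_ae (ae_of_all _ fun x => ?_)).trans (integral_zero K ℝ)
  by_cases hx : γ x / ∫ y, γ y ∂μ = 0
  · simp [hx]
  · simp [div_self hx]

lemma KL_fdot_mlem [IsFiniteMeasure μ] (hf : ∀ x, 0 < f x) (hΓ : ∀ γ ∈ Γ, ∀ x, 0 ≤ γ x)
    (hdom : ∀ γ ∈ Γ, 0 < ∫ x, γ x ∂μ) :
    KL (fdot f (mlem f Γ μ)) (fdot f μ) =
      ∫ x, f x * mlemDensity f Γ μ x * Real.log (mlemDensity f Γ μ x) ∂μ := by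
  have hm : Measurable (mlemDensity f Γ μ) := (continuous_mlemDensity hf).measurable
  have hfm : Measurable f := f.continuous.measurable
  unfold fdot
  rw [withDensity_mlem hf hΓ hdom hfm, KL_withDensity_ofReal μ (by fun_prop) (by fun_prop)
    (fun x => mul_nonneg (mlemDensity_nonneg hf hΓ hdom x) (hf x).le) (fun x => (hf x).le)
    (fun x hx => absurd hx (hf x).ne')]
  refine integral_congr_ae (ae_of_all _ fun x => ?_)
  simp only [mul_div_cancel_right₀ _ (hf x).ne', mul_comm (f x)]

variable [CompactSpace K] [IsFiniteMeasure μ]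

lemma integrable_of_continuous {h : K → ℝ} (hh : Continuous h) : Integrable h μ :=
  hh.integrable_of_hasCompactSupport (HasCompactSupport.of_compactSpace h)

lemma integrable_div_mul_log_mlemDensity (hf : ∀ x, 0 < f x) (hΓ : ∀ γ ∈ Γ, ∀ x, 0 ≤ γ x)
    (hdom : ∀ γ ∈ Γ, 0 < ∫ x, γ x ∂μ) {γ : C(K, ℝ)} (hγ : γ ∈ Γ) :
    Integrable (fun x => γ x / (∫ y, γ y ∂μ) * Real.log (mlemDensity f Γ μ x)) μ := by
  have hc : Continuous (mlemDensity f Γ μ) := continuous_mlemDensity hf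
  have hm : Measurable (mlemDensity f Γ μ) := hc.measurable
  have hγm : Measurable γ := γ.continuous.measurable
  refine Integrable.mono' (integrable_of_continuous (μ := μ)
    (f.continuous.mul (Real.continuous_mul_log.comp hc).abs))
    (by fun_prop) (ae_of_all _ fun x => ?_)
  have hg := mlemDensity_nonneg hf hΓ hdom x
  have hx : 0 ≤ γ x / ∫ y, γ y ∂μ := div_nonneg (hΓ γ hγ x) (hdom γ hγ).le
  simp only [Function.comp_apply, Pi.mul_apply]
  rw [Real.norm_eq_abs, abs_mul, abs_of_nonneg hx, abs_mul (mlemDensity f Γ μ x), abs_of_nonneg hg, ← mul_assoc]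
  exact mul_le_mul_of_nonneg_right (div_integral_le_mul_mlemDensity hf hΓ hdom hγ x)
    (abs_nonneg _)

lemma integral_mlem_pos (hf : ∀ x, 0 < f x) (hΓ : ∀ γ ∈ Γ, ∀ x, 0 ≤ γ x)
    (hdom : ∀ γ ∈ Γ, 0 < ∫ x, γ x ∂μ) {γ : C(K, ℝ)} (hγ : γ ∈ Γ) :
    0 < ∫ x, γ x ∂(mlem f Γ μ) := by
  have h0 (x : K) : 0 ≤ mlemDensity f Γ μ x * γ x :=
    mul_nonneg (mlemDensity_nonneg hf hΓ hdom x) (hΓ γ hγ x)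
  have hsupp : Function.support (fun x => mlemDensity f Γ μ x * γ x) = Function.support γ := by
    ext x
    simpa using fun hx => mt (eq_zero_of_mlemDensity_eq_zero hf hΓ hdom hγ) hx
  rw [integral_mlem hf hΓ hdom, integral_pos_iff_support_of_nonneg h0
    (integrable_of_continuous ((continuous_mlemDensity hf).mul γ.continuous)), hsupp,
    ← integral_pos_iff_support_of_nonneg (hΓ γ hγ) (integrable_of_continuous γ.continuous)]
  exact hdom γ hγ

lemma integral_mlem_self (hf : ∀ x, 0 < f x) (hΓ : ∀ γ ∈ Γ, ∀ x, 0 ≤ γ x)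
    (hdom : ∀ γ ∈ Γ, 0 < ∫ x, γ x ∂μ) : ∫ x, f x ∂(mlem f Γ μ) = Γ.card := by
  simp_rw [integral_mlem hf hΓ hdom, mul_comm _ (f _), mul_mlemDensity hf]
  rw [integral_finsetSum _ fun γ _ => integrable_of_continuous (γ.continuous.div_const _),
    Finset.sum_congr rfl fun γ hγ => integral_div_integral (hdom γ hγ)]
  simp

lemma KL_nug_mlem (hf : ∀ x, 0 < f x) (hΓ : ∀ γ ∈ Γ, ∀ x, 0 ≤ γ x)
    (hdom : ∀ γ ∈ Γ, 0 < ∫ x, γ x ∂μ) {γ : C(K, ℝ)} (hγ : γ ∈ Γ) :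
    KL (nug γ μ) (nug γ (mlem f Γ μ)) =
      Real.log (∫ x, γ x ∂(mlem f Γ μ)) - Real.log (∫ x, γ x ∂μ) -
        ∫ x, γ x / (∫ y, γ y ∂μ) * Real.log (mlemDensity f Γ μ x) ∂μ := by
  have hm : Measurable (mlemDensity f Γ μ) := (continuous_mlemDensity hf).measurable
  have hγm : Measurable γ := γ.continuous.measurable
  have hpos := hdom γ hγ
  have hpos' := integral_mlem_pos hf hΓ hdom hγ
  have hzero (x : K) := eq_zero_of_mlemDensity_eq_zero hf hΓ hdom hγ (x := x)
  unfold nug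
  rw [withDensity_mlem hf hΓ hdom (by fun_prop), KL_withDensity_ofReal μ (by fun_prop)
    (by fun_prop) (fun x => div_nonneg (hΓ γ hγ x) hpos.le)
    (fun x => mul_nonneg (mlemDensity_nonneg hf hΓ hdom x) (div_nonneg (hΓ γ hγ x) hpos'.le))]
  · calc
      _ = ∫ x, (γ x / (∫ y, γ y ∂μ) *
            (Real.log (∫ x, γ x ∂(mlem f Γ μ)) - Real.log (∫ x, γ x ∂μ)) -
            γ x / (∫ y, γ y ∂μ) * Real.log (mlemDensity f Γ μ x)) ∂μ := by
        refine integral_congr_ae (ae_of_all _ fun x => ?_)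
        by_cases hx : γ x = 0
        · simp [hx]
        · have hg := mt (hzero x) hx
          simp only
          rw [Real.log_div (div_ne_zero hx hpos.ne') (mul_ne_zero hg (div_ne_zero hx hpos'.ne')),
            Real.log_mul hg (div_ne_zero hx hpos'.ne'), Real.log_div hx hpos.ne',
            Real.log_div hx hpos'.ne']
          ring
      _ = _ := by
        rw [integral_sub (integrable_of_continuous (by fun_prop))
          (integrable_div_mul_log_mlemDensity hf hΓ hdom hγ), integral_mul_const,
          integral_div_integral hpos, one_mul]
  · intro x hx
    rcases mul_eq_zero.1 hx with hx | hx
    · simp [hzero x hx]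
    · simp [(div_eq_zero_iff.1 hx).resolve_right hpos'.ne']

end MLEM

/-- `Q_k(μ_k) − Q_k(μ_{k+1}) = D(f·μ_{k+1} ‖ f·μ_k)` (for `μ_k ∈ X_k`, i.e. `⟨μ_k, f⟩ = n`). -/
theorem stmt12 {K : Type*} [MetricSpace K] [CompactSpace K] [Nonempty K]
    [MeasurableSpace K] [BorelSpace K]
    (f : C(K, ℝ)) (c : ℝ) (hc : 0 < c) (hf : ∀ x : K, c ≤ f x)
    (Γ : Finset C(K, ℝ)) (hΓ : Γ.Nonempty) (hΓpos : ∀ γ ∈ Γ, ∀ x : K, 0 ≤ γ x)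
    (μk : Measure K) [IsFiniteMeasure μk] (hdom : ∀ γ ∈ Γ, 0 < ∫ x, γ x ∂μk)
    (hmass : (∫ x, f x ∂μk) = (Γ.card : ℝ)) :
    Qsur f Γ μk μk - Qsur f Γ μk (mlem f Γ μk) =
      KL (fdot f (mlem f Γ μk)) (fdot f μk) := by
  have hf0 (x : K) : 0 < f x := hc.trans_le (hf x)
  rw [KL_fdot_mlem hf0 hΓpos hdom]
  simp_rw [mul_mlemDensity hf0, Finset.sum_mul]
  rw [integral_finsetSum _ fun γ hγ => integrable_div_mul_log_mlemDensity hf0 hΓpos hdom hγ]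
  unfold Qsur lossR
  rw [Finset.sum_congr rfl fun γ hγ => KL_nug_self (hΓpos γ hγ),
    Finset.sum_congr rfl fun γ hγ => KL_nug_mlem hf0 hΓpos hdom hγ,
    integral_mlem_self hf0 hΓpos hdom, hmass]
  simp only [Finset.sum_sub_distrib, Finset.sum_const_zero]
  ring
end

section
/- If μ̄ ∈ dom(ℓ) is a fixed point of the ML-EM map (T(μ̄) = μ̄) and the topological support of μ̄ equals K̃ := ⋃_{γ∈Γ} supp(γ), then μ̄ minimizes ℓ over M_+(K). -/
open MeasureTheory Filter

/-- At a fixed point of the ML-EM map, `∑_{γ∈Γ} γ/⟨μ,γ⟩ = f` almost everywhere. -/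
theorem ae_sum_eq_of_mlem_eq_self {K : Type*} [TopologicalSpace K] [MeasurableSpace K]
    [OpensMeasurableSpace K] {f : C(K, ℝ)} (hf : ∀ x, 0 < f x) {Γ : Finset C(K, ℝ)}
    {μ : Measure K} [SigmaFinite μ] (hfix : mlem f Γ μ = μ) :
    ∀ᵐ x ∂μ, ∑ γ ∈ Γ, γ x / (∫ y, γ y ∂μ) = f x := by
  have hcont : Continuous fun x => (f x)⁻¹ * ∑ γ ∈ Γ, γ x / (∫ y, γ y ∂μ) :=
    (f.continuous.inv₀ fun x => (hf x).ne').mul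
      (continuous_finsetSum _ fun γ _ => γ.continuous.div_const _)
  have h : (fun x => ENNReal.ofReal ((f x)⁻¹ * ∑ γ ∈ Γ, γ x / (∫ y, γ y ∂μ))) =ᵐ[μ] 1 := by
    refine (withDensity_eq_iff_of_sigmaFinite hcont.measurable.ennreal_ofReal.aemeasurable
      aemeasurable_one).1 ?_
    exact hfix.trans withDensity_one.symm
  filter_upwards [h] with x hx
  rw [Pi.one_apply, ENNReal.ofReal_eq_one, inv_mul_eq_one₀ (hf x).ne'] at hx
  exact hx.symm

/-- Continuous functions which agree almost everywhere agree on the support of the measure. -/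
theorem eq_of_ae_eq_of_mem_msupport {K Y : Type*} [TopologicalSpace K] [MeasurableSpace K]
    [TopologicalSpace Y] [T2Space Y] {μ : Measure K} {g h : K → Y} (hg : Continuous g)
    (hh : Continuous h) (hae : ∀ᵐ x ∂μ, g x = h x) {x : K} (hx : x ∈ msupport μ) :
    g x = h x := by
  by_contra hne
  exact hx {y | g y ≠ h y} hne (isOpen_ne_fun hg hh) hae

/-- If `∑_{γ∈Γ} γ/⟨μ,γ⟩ ≤ f` everywhere, with equality `μ`-almost everywhere, then `μ` minimizes
the loss. -/
theorem loss_le_of_sum_le {K : Type*} [TopologicalSpace K] [CompactSpace K]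
    [MeasurableSpace K] [BorelSpace K] {f : C(K, ℝ)} {Γ : Finset C(K, ℝ)}
    {μ : Measure K} [IsFiniteMeasure μ] (hdom : ∀ γ ∈ Γ, 0 < ∫ x, γ x ∂μ)
    (hle : ∀ x, ∑ γ ∈ Γ, γ x / (∫ y, γ y ∂μ) ≤ f x)
    (hae : ∀ᵐ x ∂μ, ∑ γ ∈ Γ, γ x / (∫ y, γ y ∂μ) = f x)
    (ν : Measure K) [IsFiniteMeasure ν] : loss f Γ μ ≤ loss f Γ ν := by
  have hint (ρ : Measure K) [IsFiniteMeasure ρ] (γ : C(K, ℝ)) : Integrable (fun x => γ x) ρ :=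
    γ.continuous.integrable_of_hasCompactSupport (HasCompactSupport.of_compactSpace _)
  have hsum (ρ : Measure K) [IsFiniteMeasure ρ] :
      ∫ x, ∑ γ ∈ Γ, γ x / (∫ y, γ y ∂μ) ∂ρ = ∑ γ ∈ Γ, (∫ x, γ x ∂ρ) / (∫ y, γ y ∂μ) := by
    rw [integral_finsetSum _ fun γ _ => (hint ρ γ).div_const _]
    simp only [integral_div]
  by_cases hν : ∀ γ ∈ Γ, 0 < ∫ x, γ x ∂ν
  · rw [loss, loss, if_pos hdom, if_pos hν, EReal.coe_le_coe_iff]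
    have hμf : ∫ x, f x ∂μ = ∑ γ ∈ Γ, (1 : ℝ) := by
      rw [← integral_congr_ae hae, hsum μ]
      exact Finset.sum_congr rfl fun γ hγ => div_self (hdom γ hγ).ne'
    have hνf : ∑ γ ∈ Γ, (∫ x, γ x ∂ν) / (∫ y, γ y ∂μ) ≤ ∫ x, f x ∂ν := by
      rw [← hsum ν]
      exact integral_mono (integrable_finsetSum _ fun γ _ => (hint ν γ).div_const _)
        (hint ν f) hle
    have hlog : ∑ γ ∈ Γ, (Real.log (∫ x, γ x ∂ν) - Real.log (∫ x, γ x ∂μ)) ≤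
        ∑ γ ∈ Γ, ((∫ x, γ x ∂ν) / (∫ y, γ y ∂μ) - 1) := by
      refine Finset.sum_le_sum fun γ hγ => ?_
      rw [← Real.log_div (hν γ hγ).ne' (hdom γ hγ).ne']
      exact Real.log_le_sub_one_of_pos (div_pos (hν γ hγ) (hdom γ hγ))
    rw [Finset.sum_sub_distrib, Finset.sum_sub_distrib] at hlog
    linarith
  · rw [loss, loss, if_neg hν]
    exact le_top

/-- A fixed point of the ML-EM map whose support equals `K̃` minimizes the loss. -/
theorem stmt16 {K : Type*} [MetricSpace K] [CompactSpace K] [Nonempty K]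
    [MeasurableSpace K] [BorelSpace K]
    (f : C(K, ℝ)) (c : ℝ) (hc : 0 < c) (hf : ∀ x : K, c ≤ f x)
    (Γ : Finset C(K, ℝ)) (hΓ : Γ.Nonempty) (hΓpos : ∀ γ ∈ Γ, ∀ x : K, 0 ≤ γ x)
    (μbar : Measure K) [IsFiniteMeasure μbar] (hdom : ∀ γ ∈ Γ, 0 < ∫ x, γ x ∂μbar)
    (hfix : mlem f Γ μbar = μbar)
    (hsupp : msupport μbar = ⋃ γ ∈ Γ, tsupport ⇑γ) :
    ∀ ν : Measure K, IsFiniteMeasure ν → loss f Γ μbar ≤ loss f Γ ν := by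
  intro ν _
  have hfpos (x : K) : 0 < f x := hc.trans_le (hf x)
  have hae := ae_sum_eq_of_mlem_eq_self hfpos hfix
  refine loss_le_of_sum_le hdom (fun x => ?_) hae ν
  by_cases hx : x ∈ msupport μbar
  · exact (eq_of_ae_eq_of_mem_msupport
      (continuous_finsetSum _ fun γ _ => γ.continuous.div_const _) f.continuous hae hx).le
  · simp only [hsupp, Set.mem_iUnion, not_exists] at hx
    rw [Finset.sum_eq_zero fun γ hγ => by rw [image_eq_zero_of_notMem_tsupport (hx γ hγ), zero_div]]
    exact (hfpos x).le
end

section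
/- The loss ℓ is sequentially weak-* continuous on its domain: if (μ_j) ⊂ dom(ℓ) converges weak-* to μ̄ ∈ dom(ℓ) (i.e. ⟨μ_j, g⟩ → ⟨μ̄, g⟩ for every continuous g on K), then ℓ(μ_j) → ℓ(μ̄); moreover, if μ_j → μ̄ weak-* with μ̄ ∉ dom(ℓ) but every μ_j ∈ dom(ℓ), then ℓ(μ_j) → +∞. -/
open MeasureTheory Filter

/-- The loss is sequentially weak-* continuous on its domain, and blows up to `+∞` along
sequences in the domain converging weak-* to a measure outside the domain. -/
theorem stmt19 {K : Type*} [MetricSpace K] [CompactSpace K] [Nonempty K]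
    [MeasurableSpace K] [BorelSpace K]
    (f : C(K, ℝ)) (c : ℝ) (hc : 0 < c) (hf : ∀ x : K, c ≤ f x)
    (Γ : Finset C(K, ℝ)) (hΓ : Γ.Nonempty) (hΓpos : ∀ γ ∈ Γ, ∀ x : K, 0 ≤ γ x)
    (μseq : ℕ → Measure K) (hfin : ∀ j : ℕ, IsFiniteMeasure (μseq j))
    (hdomseq : ∀ j : ℕ, ∀ γ ∈ Γ, 0 < ∫ x, γ x ∂(μseq j))
    (μbar : Measure K) [IsFiniteMeasure μbar]
    (hconv : ∀ g : C(K, ℝ),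
      Tendsto (fun j => ∫ x, g x ∂(μseq j)) atTop (nhds (∫ x, g x ∂μbar))) :
    ((∀ γ ∈ Γ, 0 < ∫ x, γ x ∂μbar) →
      Tendsto (fun j => lossR f Γ (μseq j)) atTop (nhds (lossR f Γ μbar))) ∧
    (¬ (∀ γ ∈ Γ, 0 < ∫ x, γ x ∂μbar) →
      Tendsto (fun j => lossR f Γ (μseq j)) atTop atTop) := by
  refine ⟨fun hpos => ?_, fun hnot => ?_⟩
  · unfold lossR
    exact (hconv f).sub
      (tendsto_finsetSum Γ fun γ hγ => (hconv γ).log (hpos γ hγ).ne')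
  · classical
    push Not at hnot
    obtain ⟨γ₀, hγ₀, hle⟩ := hnot
    have hzero : ∫ x, γ₀ x ∂μbar = 0 := le_antisymm hle (integral_nonneg (hΓpos γ₀ hγ₀))
    have hwithin : Tendsto (fun j => ∫ x, γ₀ x ∂(μseq j)) atTop (nhdsWithin 0 (Set.Ioi 0)) :=
      tendsto_nhdsWithin_iff.2
        ⟨hzero ▸ hconv γ₀, Eventually.of_forall fun j => hdomseq j γ₀ hγ₀⟩
    have hlog : Tendsto (fun j => -Real.log (∫ x, γ₀ x ∂(μseq j))) atTop atTop :=
      tendsto_neg_atBot_atTop.comp (Real.tendsto_log_nhdsGT_zero.comp hwithin)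
    have hrest : Tendsto
        (fun j => (∫ x, f x ∂(μseq j)) - ∑ γ ∈ Γ.erase γ₀, ∫ x, γ x ∂(μseq j)) atTop
        (nhds ((∫ x, f x ∂μbar) - ∑ γ ∈ Γ.erase γ₀, ∫ x, γ x ∂μbar)) :=
      (hconv f).sub (tendsto_finsetSum _ fun γ _ => hconv γ)
    refine tendsto_atTop_mono (fun j => ?_) (hrest.add_atTop hlog)
    have hsum : ∑ γ ∈ Γ.erase γ₀, Real.log (∫ x, γ x ∂(μseq j)) ≤
        ∑ γ ∈ Γ.erase γ₀, ∫ x, γ x ∂(μseq j) :=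
      Finset.sum_le_sum fun γ hγ =>
        Real.log_le_self (hdomseq j γ (Finset.mem_of_mem_erase hγ)).le
    unfold lossR
    rw [← Finset.add_sum_erase Γ (fun γ => Real.log (∫ x, γ x ∂(μseq j))) hγ₀]
    linarith
end
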